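/- Let P be a heptagonal typical 7-configuration with points p₀,…,p₆ numbered consecutively along the cyclic order coming from convex position (indices modulo 7). If the edge [p_i, p_{i+1}] is internal, then d(p_i) + d(p_{i+1}) = 5; if it is external, then d(p_i) + d(p_{i+1}) = 7. -/

import Mathlib

open scoped LinearAlgebra.Projectivization
open Projectivization

noncomputable section

/-- The real projective plane: the projectivization of `ℝ³`. -/
abbrev RP2 := ℙ ℝ (Fin 3 → ℝ)

/-- The quotient topology on the real projective plane. -/
instance : TopologicalSpace RP2 :=
  inferInstanceAs (TopologicalSpace (Quotient (projectivizationSetoid ℝ (Fin 3 → ℝ))))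

/-- Three points of `ℙ²(ℝ)` are collinear if they admit linearly dependent representatives. -/
def Collin (a b c : RP2) : Prop :=
  ¬ LinearIndependent ℝ ![a.rep, b.rep, c.rep]

/-- The conic (zero set in `ℙ²(ℝ)`) associated to a quadratic form on `ℝ³`. -/
def ConicSet (q : QuadraticForm ℝ (Fin 3 → ℝ)) : Set RP2 := {p : RP2 | q p.rep = 0}

/-- A set of points is coconic if some conic contains all of them. -/
def Coconic (s : Set RP2) : Prop :=
  ∃ q : QuadraticForm ℝ (Fin 3 → ℝ), q ≠ 0 ∧ ∀ p ∈ s, q p.rep = 0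

/-- A labeled `n`-configuration is simple if it is injective and has no collinear triple. -/
def SimpleCfg {n : ℕ} (f : Fin n → RP2) : Prop :=
  Function.Injective f ∧
    ∀ i j k : Fin n, i ≠ j → i ≠ k → j ≠ k → ¬ Collin (f i) (f j) (f k)

/-- A labeled `n`-configuration is typical if it is simple and no six of its points are coconic. -/
def TypicalCfg {n : ℕ} (f : Fin n → RP2) : Prop :=
  SimpleCfg f ∧ ∀ g : Fin 6 → Fin n, Function.Injective g → ¬ Coconic (Set.range (f ∘ g))

/-- A projective line: the set of points whose representatives lie in a 2-dimensional
subspace of `ℝ³`. -/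
def IsProjLine (L : Set RP2) : Prop :=
  ∃ W : Submodule ℝ (Fin 3 → ℝ), Module.finrank ℝ W = 2 ∧ L = {p : RP2 | p.rep ∈ W}

/-- `p` lies inside the conic of `q` if every projective line through `p` meets the conic. -/
def InsideConic (q : QuadraticForm ℝ (Fin 3 → ℝ)) (p : RP2) : Prop :=
  ∀ L : Set RP2, IsProjLine L → p ∈ L → (L ∩ ConicSet q).Nonempty

/-- `p` lies outside the conic of `q` if some projective line through `p` misses the conic. -/
def OutsideConic (q : QuadraticForm ℝ (Fin 3 → ℝ)) (p : RP2) : Prop :=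
  ∃ L : Set RP2, IsProjLine L ∧ p ∈ L ∧ L ∩ ConicSet q = ∅

/-- A point `f i` of a configuration is dominant if it lies outside every conic passing
through all the other points of the configuration. -/
def Dominant {n : ℕ} (f : Fin n → RP2) (i : Fin n) : Prop :=
  ∀ q : QuadraticForm ℝ (Fin 3 → ℝ), q ≠ 0 → (∀ j, j ≠ i → q ((f j).rep) = 0) →
    OutsideConic q (f i)

/-- A point `f i` of a configuration is subdominant if it lies inside every conic passing
through all the other points of the configuration. -/
def Subdominant {n : ℕ} (f : Fin n → RP2) (i : Fin n) : Prop :=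
  ∀ q : QuadraticForm ℝ (Fin 3 → ℝ), q ≠ 0 → (∀ j, j ≠ i → q ((f j).rep) = 0) →
    InsideConic q (f i)

/-- The affine chart determined by a nonzero linear functional `φ` (with `L∞ = {φ = 0}`):
a point off `L∞` is sent to its representative rescaled to lie on the affine plane `φ = 1`. -/
def chart (φ : (Fin 3 → ℝ) →ₗ[ℝ] ℝ) (p : RP2) : Fin 3 → ℝ := (φ p.rep)⁻¹ • p.rep

/-- Convex position with respect to the affine chart of `φ`: the line `{φ = 0}` misses the
configuration, and in the chart every point lies outside the convex hull of the others. -/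
def ConvexPosWith {n : ℕ} (φ : (Fin 3 → ℝ) →ₗ[ℝ] ℝ) (f : Fin n → RP2) : Prop :=
  φ ≠ 0 ∧ (∀ i, φ (f i).rep ≠ 0) ∧
    ∀ i, chart φ (f i) ∉ convexHull ℝ (chart φ '' (f '' {j | j ≠ i}))

/-- A configuration is in convex position if it is so in some affine chart. -/
def ConvexPos {n : ℕ} (f : Fin n → RP2) : Prop := ∃ φ, ConvexPosWith φ f

/-- The labeling of a configuration is consecutive for the convex position in the chart of `φ`:
each pair `f i`, `f (i+1)` (cyclically) spans an edge of the convex polygon, i.e. is cut out by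
an affine functional which is strictly larger on both of them than on all the other points. -/
def ConsecWith {n : ℕ} [NeZero n] (φ : (Fin 3 → ℝ) →ₗ[ℝ] ℝ) (f : Fin n → RP2) : Prop :=
  ConvexPosWith φ f ∧
    ∀ i : Fin n, ∃ ψ : (Fin 3 → ℝ) →ₗ[ℝ] ℝ,
      ψ (chart φ (f i)) = ψ (chart φ (f (i + 1))) ∧
      ∀ j : Fin n, j ≠ i → j ≠ i + 1 → ψ (chart φ (f j)) < ψ (chart φ (f i))

/-- A configuration is in convex position with consecutive cyclic labeling. -/
def ConsecConvexPos {n : ℕ} [NeZero n] (f : Fin n → RP2) : Prop := ∃ φ, ConsecWith φ f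

/-- A Q-deformation (an `n`-tuple of continuous paths through typical configurations). -/
def QDeformFam (n : ℕ) (γ : Fin n → unitInterval → RP2) : Prop :=
  (∀ i, Continuous (γ i)) ∧ ∀ t : unitInterval, TypicalCfg (fun i => γ i t)

end
noncomputable section

/-- `f i` lies outside every conic through the five points of the 7-configuration other
than `f i` and `f j`. -/
def OutAll (f : Fin 7 → RP2) (i j : Fin 7) : Prop :=
  ∀ q : QuadraticForm ℝ (Fin 3 → ℝ), q ≠ 0 → (∀ k, k ≠ i → k ≠ j → q ((f k).rep) = 0) →
    OutsideConic q (f i)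

open Classical in
/-- `d_{i,j}` equals 1 if `f i` lies outside every conic through the five remaining points,
and 0 otherwise (i.e. if it lies inside every such conic). -/
def dIdx (f : Fin 7 → RP2) (i j : Fin 7) : ℕ :=
  if OutAll f i j then 1 else 0

/-- The dominance index `d(p_i) = Σ_{j ≠ i} d_{i,j}`. -/
def domIdx (f : Fin 7 → RP2) (i : Fin 7) : ℕ :=
  ∑ j ∈ Finset.univ.erase i, dIdx f i j
/-- The edge `[p_i, p_{i+1}]` of the heptagon is internal: `d_{i,i+1} = d_{i+1,i} = 0`. -/
def InternalEdge (f : Fin 7 → RP2) (i : Fin 7) : Prop :=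
  dIdx f i (i + 1) = 0 ∧ dIdx f (i + 1) i = 0

/-- The edge `[p_i, p_{i+1}]` of the heptagon is external: `d_{i,i+1} = d_{i+1,i} = 1`. -/
def ExternalEdge (f : Fin 7 → RP2) (i : Fin 7) : Prop :=
  dIdx f i (i + 1) = 1 ∧ dIdx f (i + 1) i = 1

/-- The edge `[p_i, p_{i+1}]` of the heptagon is special: neither internal nor external. -/
def SpecialEdge (f : Fin 7 → RP2) (i : Fin 7) : Prop :=
  ¬ InternalEdge f i ∧ ¬ ExternalEdge f i

/-- The linear form `z ↦ det (x, y, z)` on `ℝ³`. -/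
def bracket (x y : Fin 3 → ℝ) : (Fin 3 → ℝ) →ₗ[ℝ] ℝ where
  toFun z := (x 1 * y 2 - x 2 * y 1) * z 0 + (x 2 * y 0 - x 0 * y 2) * z 1 +
    (x 0 * y 1 - x 1 * y 0) * z 2
  map_add' u v := by simp only [Pi.add_apply]; ring
  map_smul' r u := by simp only [Pi.smul_apply, smul_eq_mul, RingHom.id_apply]; ring

theorem bracket_apply (x y z : Fin 3 → ℝ) :
    bracket x y z = (x 1 * y 2 - x 2 * y 1) * z 0 + (x 2 * y 0 - x 0 * y 2) * z 1 +
      (x 0 * y 1 - x 1 * y 0) * z 2 := rfl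

theorem bracket_self_left (x y : Fin 3 → ℝ) : bracket x y x = 0 := by
  simp only [bracket_apply]; ring

theorem bracket_self_right (x y : Fin 3 → ℝ) : bracket x y y = 0 := by
  simp only [bracket_apply]; ring

theorem bracket_ne_zero_iff (x y z : Fin 3 → ℝ) :
    bracket x y z ≠ 0 ↔ LinearIndependent ℝ ![x, y, z] := by
  have h := Matrix.linearIndependent_rows_iff_isUnit (K := ℝ) (A := Matrix.of ![x, y, z])
  rw [Matrix.isUnit_iff_isUnit_det, isUnit_iff_ne_zero, Matrix.det_fin_three] at h
  refine Iff.trans ?_ h.symm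
  rw [bracket_apply]
  simp only [Matrix.of_apply, Matrix.cons_val_zero, Matrix.cons_val_one, Matrix.cons_val]
  exact not_congr (by constructor <;> intro h <;> linear_combination h)

theorem exists_eq_combination {x y z : Fin 3 → ℝ} (h : bracket x y z ≠ 0) (w : Fin 3 → ℝ) :
    ∃ r s : ℝ, w = r • x + s • y + (bracket x y w / bracket x y z) • z := by
  refine ⟨bracket y z w / bracket x y z, bracket z x w / bracket x y z, ?_⟩
  have key : bracket x y z • w = bracket y z w • x + bracket z x w • y + bracket x y w • z := by
    ext i
    simp only [bracket_apply, Pi.add_apply, Pi.smul_apply, smul_eq_mul]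
    fin_cases i <;> simp only [Fin.zero_eta, Fin.mk_one, Fin.reduceFinMk] <;> ring
  calc w = (bracket x y z)⁻¹ • (bracket x y z • w) := by
        rw [smul_smul, inv_mul_cancel₀ h, one_smul]
    _ = _ := by simp only [key, smul_add, smul_smul, div_eq_inv_mul]

/-- The line of `ℙ²(ℝ)` spanned by some vector together with `v` misses the conic `q = 0`. -/
def AnisotropicPlane (q : QuadraticForm ℝ (Fin 3 → ℝ)) (v : Fin 3 → ℝ) : Prop :=
  ∃ W : Submodule ℝ (Fin 3 → ℝ), Module.finrank ℝ W = 2 ∧ v ∈ W ∧ ∀ x ∈ W, q x = 0 → x = 0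

theorem outsideConic_iff (q : QuadraticForm ℝ (Fin 3 → ℝ)) (p : RP2) {r : ℝ} (hr : r ≠ 0) :
    OutsideConic q p ↔ AnisotropicPlane q (r • p.rep) := by
  constructor
  · rintro ⟨L, ⟨W, hW, rfl⟩, hp, hL⟩
    refine ⟨W, hW, W.smul_mem _ hp, fun x hx hq => ?_⟩
    by_contra hx0
    obtain ⟨a, ha⟩ := exists_smul_eq_mk_rep ℝ x hx0
    have : Projectivization.mk ℝ x hx0 ∈ ({p : RP2 | p.rep ∈ W} ∩ ConicSet q) := by
      refine ⟨?_, ?_⟩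
      · change (Projectivization.mk ℝ x hx0).rep ∈ W
        rw [← ha]; exact W.smul_mem (a : ℝ) hx
      · change q (Projectivization.mk ℝ x hx0).rep = 0
        rw [← ha, Units.smul_def, QuadraticMap.map_smul, hq, smul_zero]
    rw [hL] at this
    exact this
  · rintro ⟨W, hW, hp, h⟩
    refine ⟨{p : RP2 | p.rep ∈ W}, ⟨W, hW, rfl⟩, (W.smul_mem_iff hr).1 hp, ?_⟩
    ext x
    simp only [Set.mem_inter_iff, Set.mem_empty_iff_false, iff_false, not_and]
    exact fun hx hq => x.rep_nonzero (h _ hx hq)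

theorem quadraticForm_combination (q : QuadraticForm ℝ (Fin 3 → ℝ)) (x y : Fin 3 → ℝ) (s t : ℝ) :
    q (s • x + t • y) = s * s * q x + t * t * q y + s * t * QuadraticMap.polar q x y := by
  rw [QuadraticMap.map_add q, QuadraticMap.map_smul, QuadraticMap.map_smul,
    QuadraticMap.polar_smul_left, QuadraticMap.polar_smul_right]
  simp only [smul_eq_mul]; ring

open QuadraticMap in
theorem AnisotropicPlane.of_gram_pos {q : QuadraticForm ℝ (Fin 3 → ℝ)} {v w : Fin 3 → ℝ}
    (hv : q v ≠ 0) (h : 0 < 4 * q v * q w - polar q v w ^ 2) : AnisotropicPlane q v := by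
  have key : ∀ l m : ℝ, q (l • v + m • w) = 0 → l = 0 ∧ m = 0 := by
    intro l m h0
    rw [quadraticForm_combination] at h0
    have h1 : (2 * q v * l + m * polar q v w) ^ 2 +
        m ^ 2 * (4 * q v * q w - polar q v w ^ 2) = 0 := by
      linear_combination 4 * q v * h0
    have hm : m = 0 := by
      by_contra hm
      have := mul_pos (pow_two_pos_of_ne_zero hm) h
      nlinarith [sq_nonneg (2 * q v * l + m * polar q v w)]
    subst hm
    refine ⟨?_, rfl⟩
    have : (q v * l) = 0 := by
      rw [← sq_eq_zero_iff]; linear_combination h1 / 4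
    exact (mul_eq_zero.1 this).resolve_left hv
  have hli : LinearIndependent ℝ ![v, w] := by
    rw [LinearIndependent.pair_iff]
    intro l m h0
    exact key l m (by rw [h0, QuadraticMap.map_zero])
  refine ⟨Submodule.span ℝ {v, w}, ?_, Submodule.subset_span (by simp), ?_⟩
  · have := finrank_span_eq_card hli
    rwa [Matrix.range_cons_cons_empty, Fintype.card_fin] at this
  · intro x hx h0
    obtain ⟨l, m, rfl⟩ := Submodule.mem_span_pair.1 hx
    obtain ⟨rfl, rfl⟩ := key l m h0
    simp

theorem exists_binary_form_pos {A B C : ℝ} (h : A * C - B ^ 2 < 0) (hA : A ≤ 0) (hC : C ≤ 0) :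
    ∃ s t : ℝ, 0 < A * s ^ 2 + 2 * B * s * t + C * t ^ 2 := by
  rcases hA.lt_or_eq with hA | rfl
  · exact ⟨-B, A, by nlinarith [mul_pos_of_neg_of_neg hA h]⟩
  · rcases hC.lt_or_eq with hC | rfl
    · exact ⟨C, -B, by nlinarith [mul_pos_of_neg_of_neg hC h]⟩
    · exact ⟨1, B, by nlinarith⟩

theorem binary_form_nonpos {A B C : ℝ} (h : 0 < A * C - B ^ 2) (hA : A ≤ 0) (s t : ℝ) :
    A * s ^ 2 + 2 * B * s * t + C * t ^ 2 ≤ 0 := by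
  rcases hA.lt_or_eq with hA | rfl
  · by_contra! hc
    nlinarith [mul_neg_of_neg_of_pos hA hc, sq_nonneg (A * s + B * t),
      mul_nonneg h.le (sq_nonneg t)]
  · nlinarith [sq_nonneg B]

open QuadraticMap in
theorem gram_combination_of_isotropic {q : QuadraticForm ℝ (Fin 3 → ℝ)} {c d : Fin 3 → ℝ}
    (hc : q c = 0) (hd : q d = 0) (v : Fin 3 → ℝ) (s t : ℝ) :
    4 * q v * q (s • c + t • d) - polar q v (s • c + t • d) ^ 2 =
      -(polar q v c) ^ 2 * s ^ 2 +
        2 * (2 * q v * polar q c d - polar q v c * polar q v d) * s * t +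
        -(polar q v d) ^ 2 * t ^ 2 := by
  rw [quadraticForm_combination, polar_add_right, polar_smul_right, polar_smul_right, hc, hd]
  simp only [smul_eq_mul]; ring

open QuadraticMap in
theorem anisotropicPlane_iff {q : QuadraticForm ℝ (Fin 3 → ℝ)} {v c d : Fin 3 → ℝ}
    (hb : bracket c d v ≠ 0) (hc : q c = 0) (hd : q d = 0)
    (hne : q v * polar q c d * (polar q v c * polar q v d - q v * polar q c d) ≠ 0) :
    AnisotropicPlane q v ↔
      q v * polar q c d * (polar q v c * polar q v d - q v * polar q c d) < 0 := by
  have hv : q v ≠ 0 := fun h => hne (by rw [h]; ring)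
  constructor
  · rintro ⟨W, hW, hvW, hani⟩
    by_contra hD
    have hD : 0 < q v * polar q c d * (polar q v c * polar q v d - q v * polar q c d) :=
      lt_of_le_of_ne (not_lt.1 hD) hne.symm
    have hv0 : v ≠ 0 := fun h => hv (by rw [h, QuadraticMap.map_zero])
    obtain ⟨w, hwW, hw⟩ : ∃ w ∈ W, w ∉ Submodule.span ℝ {v} := by
      by_contra! hcon
      have := Submodule.finrank_mono (show W ≤ Submodule.span ℝ {v} from hcon)
      rw [hW, finrank_span_singleton hv0] at this
      omega
    obtain ⟨s, t, hst⟩ := exists_eq_combination hb w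
    set r := bracket c d w / bracket c d v
    set u := s • c + t • d with hu
    have huw : u = w - r • v := by rw [hst, add_sub_cancel_right]
    have huW : u ∈ W := huw ▸ W.sub_mem hwW (W.smul_mem _ hvW)
    have hG := gram_combination_of_isotropic hc hd v s t
    rw [← hu] at hG
    have hle := binary_form_nonpos (A := -(polar q v c) ^ 2) (C := -(polar q v d) ^ 2)
      (B := 2 * q v * polar q c d - polar q v c * polar q v d)
      (by nlinarith) (by nlinarith [sq_nonneg (polar q v c)]) s t
    rw [← hG] at hle
    obtain ⟨l, hl⟩ := exists_quadratic_eq_zero (a := q v) (b := polar q v u) (c := q u) hv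
      ⟨√(polar q v u ^ 2 - 4 * q v * q u), by
        rw [Real.mul_self_sqrt (by linarith), discrim]⟩
    have h0 := hani (l • v + u) (W.add_mem (W.smul_mem _ hvW) huW) (by
      have := quadraticForm_combination q v u l 1
      rw [one_smul] at this
      rw [this]; linear_combination hl)
    apply hw
    rw [Submodule.mem_span_singleton]
    refine ⟨r - l, ?_⟩
    rw [huw] at h0
    rw [sub_smul, ← sub_eq_zero, ← neg_eq_zero, ← h0]
    abel
  · intro hD
    obtain ⟨s, t, hst⟩ := exists_binary_form_pos (A := -(polar q v c) ^ 2)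
      (C := -(polar q v d) ^ 2) (B := 2 * q v * polar q c d - polar q v c * polar q v d)
      (by nlinarith) (by nlinarith [sq_nonneg (polar q v c)])
      (by nlinarith [sq_nonneg (polar q v d)])
    rw [← gram_combination_of_isotropic hc hd v s t] at hst
    exact .of_gram_pos hv hst

/-- The conic through `b`, written in the pencil of conics through `c, d, e, f`. -/
def pencilConic (b c d e f : Fin 3 → ℝ) : QuadraticForm ℝ (Fin 3 → ℝ) :=
  (bracket d e b * bracket f c b) • QuadraticMap.linMulLin (bracket c d) (bracket e f) -
    (bracket c d b * bracket e f b) • QuadraticMap.linMulLin (bracket d e) (bracket f c)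

theorem pencilConic_apply (b c d e f x : Fin 3 → ℝ) :
    pencilConic b c d e f x =
      bracket d e b * bracket f c b * (bracket c d x * bracket e f x) -
        bracket c d b * bracket e f b * (bracket d e x * bracket f c x) := rfl

theorem polar_pencilConic (b c d e f x y : Fin 3 → ℝ) :
    QuadraticMap.polar (pencilConic b c d e f) x y =
      bracket d e b * bracket f c b *
          (bracket c d x * bracket e f y + bracket c d y * bracket e f x) -
        bracket c d b * bracket e f b *
          (bracket d e x * bracket f c y + bracket d e y * bracket f c x) := by
  simp only [QuadraticMap.polar, pencilConic_apply, map_add]; ring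

theorem pencilConic_apply_symm (a b c d e f : Fin 3 → ℝ) :
    pencilConic a c d e f b = -pencilConic b c d e f a := by
  simp only [pencilConic_apply]; ring

theorem bracket_pencil_eq (b c d e f : Fin 3 → ℝ) :
    bracket d e b * bracket f c b - bracket c d b * bracket e f b =
      -(bracket c e b * bracket d f b) := by
  simp only [bracket_apply]; ring

theorem bracket_cubic_eq (a c d e f : Fin 3 → ℝ) :
    bracket e f c * bracket d e a * bracket f c d + bracket d e c * bracket f c a * bracket e f d -
      bracket d e c * bracket f c d * bracket e f a =
      bracket c d a * bracket e f c * bracket e f d := by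
  simp only [bracket_apply]; ring

theorem pencilConic_discrim (a b c d e f : Fin 3 → ℝ) :
    pencilConic b c d e f a * QuadraticMap.polar (pencilConic b c d e f) c d *
      (QuadraticMap.polar (pencilConic b c d e f) a c *
          QuadraticMap.polar (pencilConic b c d e f) a d -
        pencilConic b c d e f a * QuadraticMap.polar (pencilConic b c d e f) c d) =
    pencilConic b c d e f a *
      ((bracket d e b * bracket f c b) * (bracket c d b * bracket e f b) *
        (bracket c e b * bracket d f b)) *
      (bracket d e c * bracket f c d * bracket e f c * bracket e f d) * bracket c d a ^ 2 := by
  have h1 := bracket_pencil_eq b c d e f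
  have h2 := bracket_cubic_eq a c d e f
  have hk : QuadraticMap.polar (pencilConic b c d e f) a c *
          QuadraticMap.polar (pencilConic b c d e f) a d -
        pencilConic b c d e f a * QuadraticMap.polar (pencilConic b c d e f) c d =
      -(bracket d e b * bracket f c b) * bracket c d a ^ 2 * bracket e f c * bracket e f d *
        (bracket c e b * bracket d f b) := by
    simp only [polar_pencilConic, pencilConic_apply, bracket_self_left, bracket_self_right]
    generalize bracket d e b * bracket f c b = α at *
    generalize bracket c d b * bracket e f b = β at *
    linear_combination α * bracket c d a ^ 2 * bracket e f c * bracket e f d * h1 -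
      α * β * bracket c d a * h2
  have hcd : QuadraticMap.polar (pencilConic b c d e f) c d =
      -(bracket c d b * bracket e f b) * (bracket d e c * bracket f c d) := by
    simp only [polar_pencilConic, bracket_self_left, bracket_self_right]
    ring
  rw [hk, hcd]
  ring

theorem anisotropicPlane_pencilConic_iff_not {a b c d e f : Fin 3 → ℝ}
    (hq : pencilConic b c d e f a ≠ 0)
    (hK : bracket d e c * bracket f c d * bracket e f c * bracket e f d ≠ 0)
    (hcd : 0 < bracket c d a * bracket c d b) (hce : 0 < bracket c e a * bracket c e b)
    (hfc : 0 < bracket f c a * bracket f c b) (hde : 0 < bracket d e a * bracket d e b)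
    (hdf : 0 < bracket d f a * bracket d f b) (hef : 0 < bracket e f a * bracket e f b) :
    AnisotropicPlane (pencilConic b c d e f) a ↔
      ¬ AnisotropicPlane (pencilConic a c d e f) b := by
  have hzero : ∀ x, pencilConic x c d e f c = 0 ∧ pencilConic x c d e f d = 0 := fun x => by
    simp [pencilConic_apply, bracket_self_left, bracket_self_right]
  have hT : 0 < ((bracket d e a * bracket f c a) * (bracket c d a * bracket e f a) *
        (bracket c e a * bracket d f a)) * ((bracket d e b * bracket f c b) *
        (bracket c d b * bracket e f b) * (bracket c e b * bracket d f b)) := by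
    have := mul_pos (mul_pos (mul_pos hde hfc) (mul_pos hcd hef)) (mul_pos hce hdf)
    linear_combination this
  have hA := pencilConic_discrim a b c d e f
  have hB := pencilConic_discrim b a c d e f
  rw [pencilConic_apply_symm a b c d e f] at hB
  set Ta := ((bracket d e a * bracket f c a) * (bracket c d a * bracket e f a) *
        (bracket c e a * bracket d f a))
  set Tb := ((bracket d e b * bracket f c b) * (bracket c d b * bracket e f b) *
        (bracket c e b * bracket d f b))
  set K := bracket d e c * bracket f c d * bracket e f c * bracket e f d
  have ha : bracket c d a ≠ 0 := left_ne_zero_of_mul hcd.ne'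
  have hb : bracket c d b ≠ 0 := right_ne_zero_of_mul hcd.ne'
  have hTa : Ta ≠ 0 := left_ne_zero_of_mul hT.ne'
  have hTb : Tb ≠ 0 := right_ne_zero_of_mul hT.ne'
  have hne : ∀ {x y z w : ℝ}, x ≠ 0 → y ≠ 0 → z ≠ 0 → w ≠ 0 → x * y * z * w ^ 2 ≠ 0 :=
    fun h1 h2 h3 h4 => mul_ne_zero (mul_ne_zero (mul_ne_zero h1 h2) h3) (pow_ne_zero 2 h4)
  rw [anisotropicPlane_iff ha (hzero b).1 (hzero b).2 (hA ▸ hne hq hTb hK ha),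
    anisotropicPlane_iff hb (hzero a).1 (hzero a).2
      (by rw [pencilConic_apply_symm a b c d e f, hB]
          exact hne (neg_ne_zero.2 hq) hTa hK hb), pencilConic_apply_symm a b c d e f, hA, hB]
  have hprod : (pencilConic b c d e f a * Tb * K * bracket c d a ^ 2) *
      (-pencilConic b c d e f a * Ta * K * bracket c d b ^ 2) < 0 := by
    have h1 : 0 < (pencilConic b c d e f a * K * bracket c d a * bracket c d b) ^ 2 :=
      pow_two_pos_of_ne_zero (mul_ne_zero (mul_ne_zero (mul_ne_zero hq hK) ha) hb)
    nlinarith [mul_pos hT h1]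
  rw [not_lt]
  constructor
  · intro h
    by_contra! h'
    exact hprod.not_gt (mul_pos_of_neg_of_neg h h')
  · intro h
    by_contra! h'
    exact hprod.not_ge (mul_nonneg h' h)

theorem mem_convexHull_of_combination {a b x y : Fin 3 → ℝ} {l m n k : ℝ} (hl : 0 < l)
    (hm : 0 ≤ m) (hn : 0 ≤ n) (hk : 0 ≤ k) (hsum : m + n + k = l)
    (h : l • x = m • a + n • b + k • y) : x ∈ convexHull ℝ ({a, b, y} : Set (Fin 3 → ℝ)) := by
  have := (convex_convexHull ℝ ({a, b, y} : Set (Fin 3 → ℝ))).sum_mem (t := Finset.univ)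
    (w := ![m / l, n / l, k / l]) (z := ![a, b, y])
    (by intro i _; fin_cases i <;> simp <;> positivity)
    (by simp [Fin.sum_univ_three]; field_simp; exact hsum)
    (by intro i _; apply subset_convexHull; fin_cases i <;> simp)
  convert this using 1
  rw [Fin.sum_univ_three]
  simp only [Matrix.cons_val_zero, Matrix.cons_val_one, Matrix.cons_val, div_eq_inv_mul,
    ← smul_smul, ← smul_add]
  rw [← h, smul_smul, inv_mul_cancel₀ hl.ne', one_smul]

/-- In a convex polygon, the line through two vertices other than `a` and `b` does not separate
the endpoints of an edge `[a, b]`. -/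
theorem bracket_mul_pos_of_edge {φ ψ : (Fin 3 → ℝ) →ₗ[ℝ] ℝ} {a b x y : Fin 3 → ℝ}
    (ha : φ a = 1) (hb : φ b = 1) (hx : φ x = 1) (hy : φ y = 1)
    (hab : ψ a = ψ b) (hxa : ψ x < ψ a) (hya : ψ y < ψ a)
    (hxh : x ∉ convexHull ℝ ({a, b, y} : Set (Fin 3 → ℝ)))
    (hyh : y ∉ convexHull ℝ ({a, b, x} : Set (Fin 3 → ℝ)))
    (hA : bracket x y a ≠ 0) (hB : bracket x y b ≠ 0) :
    0 < bracket x y a * bracket x y b := by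
  by_contra hneg
  have hw : bracket x y b / bracket x y a < 0 := by
    have : bracket x y a * bracket x y b < 0 :=
      lt_of_le_of_ne (not_lt.1 hneg) (mul_ne_zero hA hB)
    rw [div_neg_iff]
    rcases mul_neg_iff.1 this with h | h
    · exact Or.inr ⟨h.2, h.1⟩
    · exact Or.inl ⟨h.2, h.1⟩
  obtain ⟨r, s, hbe⟩ := exists_eq_combination hA b
  set w := bracket x y b / bracket x y a
  have hφ := congrArg φ hbe
  have hψ := congrArg ψ hbe
  simp only [map_add, map_smul, smul_eq_mul, ha, hb, hx, hy] at hφ hψ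
  rcases lt_or_ge s 0 with hs | hs
  · refine hxh (mem_convexHull_of_combination (l := r) (m := -w) (n := 1) (k := -s)
      (by linarith) (by linarith) zero_le_one (by linarith) (by linarith) ?_)
    rw [hbe]; module
  · rcases lt_or_ge r 0 with hr | hr
    · refine hyh (mem_convexHull_of_combination (l := s) (m := -w) (n := 1) (k := -r)
        (by linarith) (by linarith) zero_le_one (by linarith) (by linarith) ?_)
      rw [hbe]; module
    · rw [← hab] at hψ
      have hrs : r + s = 1 - w := by linarith
      have h0 : r * (ψ a - ψ x) + s * (ψ a - ψ y) = 0 := by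
        linear_combination ψ a * hrs + hψ
      have h1 := mul_nonneg hr (sub_nonneg.2 hxa.le)
      have h2 := mul_nonneg hs (sub_nonneg.2 hya.le)
      have h3 : r = 0 :=
        (mul_eq_zero.1 (by linarith : r * (ψ a - ψ x) = 0)).resolve_right (sub_ne_zero.2 hxa.ne')
      have h4 : s = 0 :=
        (mul_eq_zero.1 (by linarith : s * (ψ a - ψ y) = 0)).resolve_right (sub_ne_zero.2 hya.ne')
      linarith

theorem TypicalCfg.eq_zero_of_forall_ne {f : Fin 7 → RP2} (hf : TypicalCfg f) (j : Fin 7)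
    {q : QuadraticForm ℝ (Fin 3 → ℝ)} (h : ∀ k, k ≠ j → q (f k).rep = 0) : q = 0 := by
  by_contra hq
  refine hf.2 j.succAbove Fin.succAbove_right_injective ⟨q, hq, ?_⟩
  rintro _ ⟨k, rfl⟩
  exact h _ (Fin.succAbove_ne j k)

/-- In a typical configuration the conic through five points is unique. -/
theorem outAll_iff_outsideConic {f : Fin 7 → RP2} (hf : TypicalCfg f) {i j : Fin 7}
    {q : QuadraticForm ℝ (Fin 3 → ℝ)} (hq : q ≠ 0)
    (h : ∀ k, k ≠ i → k ≠ j → q (f k).rep = 0) : OutAll f i j ↔ OutsideConic q (f i) := by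
  refine ⟨fun ho => ho q hq h, fun ho q' hq' h' => ?_⟩
  have hne : ∀ {p : QuadraticForm ℝ (Fin 3 → ℝ)}, p ≠ 0 →
      (∀ k, k ≠ i → k ≠ j → p (f k).rep = 0) → p (f i).rep ≠ 0 := by
    intro p hp hz h0
    refine hp (hf.eq_zero_of_forall_ne j fun k hk => ?_)
    by_cases hki : k = i
    · rw [hki, h0]
    · exact hz k hki hk
  have hi := hne hq h
  have hi' := hne hq' h'
  have hs : q (f i).rep • q' - q' (f i).rep • q = 0 := by
    refine hf.eq_zero_of_forall_ne j fun k hk => ?_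
    simp only [sub_apply, smul_apply, smul_eq_mul]
    by_cases hki : k = i
    · rw [hki]; ring
    · rw [h k hki hk, h' k hki hk]; ring
  have hset : ConicSet q' = ConicSet q := by
    ext p
    have hp : q (f i).rep * q' p.rep - q' (f i).rep * q p.rep = 0 := by
      simpa using congrArg (fun Q : QuadraticForm ℝ (Fin 3 → ℝ) => Q p.rep) hs
    change q' p.rep = 0 ↔ q p.rep = 0
    constructor <;> intro h0 <;> rw [h0] at hp <;> simpa [hi, hi'] using hp
  obtain ⟨L, hL, hpL, hLq⟩ := ho
  exact ⟨L, hL, hpL, hset ▸ hLq⟩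

theorem SimpleCfg.bracket_chart_ne_zero {n : ℕ} {f : Fin n → RP2} (hf : SimpleCfg f)
    {φ : (Fin 3 → ℝ) →ₗ[ℝ] ℝ} (hφ : ∀ i, φ (f i).rep ≠ 0) {i j k : Fin n}
    (hij : i ≠ j) (hik : i ≠ k) (hjk : j ≠ k) :
    bracket (chart φ (f i)) (chart φ (f j)) (chart φ (f k)) ≠ 0 := by
  have h := (bracket_ne_zero_iff _ _ _).2 (not_not.1 (hf.2 i j k hij hik hjk))
  have : bracket (chart φ (f i)) (chart φ (f j)) (chart φ (f k)) =
      (φ (f i).rep)⁻¹ * (φ (f j).rep)⁻¹ * (φ (f k).rep)⁻¹ *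
        bracket (f i).rep (f j).rep (f k).rep := by
    simp only [chart, bracket_apply, Pi.smul_apply, smul_eq_mul]; ring
  rw [this]
  exact mul_ne_zero (mul_ne_zero (mul_ne_zero (inv_ne_zero (hφ i)) (inv_ne_zero (hφ j)))
    (inv_ne_zero (hφ k))) h

theorem ConsecWith.bracket_mul_pos {n : ℕ} [NeZero n] {f : Fin n → RP2} (hf : SimpleCfg f)
    {φ : (Fin 3 → ℝ) →ₗ[ℝ] ℝ} (h : ConsecWith φ f) {i j k : Fin n} (hjk : j ≠ k)
    (hji : j ≠ i) (hji' : j ≠ i + 1) (hki : k ≠ i) (hki' : k ≠ i + 1) :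
    0 < bracket (chart φ (f j)) (chart φ (f k)) (chart φ (f i)) *
      bracket (chart φ (f j)) (chart φ (f k)) (chart φ (f (i + 1))) := by
  obtain ⟨⟨-, hφ, hconv⟩, hedge⟩ := h
  obtain ⟨ψ, hψ, hlt⟩ := hedge i
  have h1 : ∀ l, φ (chart φ (f l)) = 1 := fun l => by
    rw [chart, map_smul, smul_eq_mul, inv_mul_cancel₀ (hφ l)]
  have hhull : ∀ l m, l ≠ m → l ≠ i → l ≠ i + 1 → chart φ (f l) ∉
      convexHull ℝ {chart φ (f i), chart φ (f (i + 1)), chart φ (f m)} := by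
    intro l m hlm hli hli' hmem
    refine hconv l (convexHull_mono ?_ hmem)
    rintro _ (rfl | rfl | rfl)
    · exact ⟨_, ⟨i, hli.symm, rfl⟩, rfl⟩
    · exact ⟨_, ⟨i + 1, hli'.symm, rfl⟩, rfl⟩
    · exact ⟨_, ⟨m, hlm.symm, rfl⟩, rfl⟩
  exact bracket_mul_pos_of_edge (h1 _) (h1 _) (h1 _) (h1 _) hψ (hlt j hji hji') (hlt k hki hki')
    (hhull j k hjk hji hji') (hhull k j hjk.symm hki hki')
    (hf.bracket_chart_ne_zero hφ hjk hji hki) (hf.bracket_chart_ne_zero hφ hjk hji' hki')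

theorem outAll_iff_anisotropicPlane {f : Fin 7 → RP2} (hf : TypicalCfg f)
    {φ : (Fin 3 → ℝ) →ₗ[ℝ] ℝ} (hφ : ∀ i, φ (f i).rep ≠ 0) {i j : Fin 7}
    {q : QuadraticForm ℝ (Fin 3 → ℝ)} (hq : q ≠ 0)
    (h : ∀ k, k ≠ i → k ≠ j → q (chart φ (f k)) = 0) :
    (OutAll f i j ↔ AnisotropicPlane q (chart φ (f i))) ∧ q (chart φ (f i)) ≠ 0 := by
  have hrep : ∀ k, q (chart φ (f k)) = 0 → q (f k).rep = 0 := fun k hk => by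
    rw [chart, QuadraticMap.map_smul, smul_eq_mul] at hk
    exact (mul_eq_zero.1 hk).resolve_left (mul_ne_zero (inv_ne_zero (hφ k)) (inv_ne_zero (hφ k)))
  refine ⟨(outAll_iff_outsideConic hf hq fun k hi hj => hrep k (h k hi hj)).trans
    (outsideConic_iff q (f i) (inv_ne_zero (hφ i))), fun h0 => ?_⟩
  refine hq (hf.eq_zero_of_forall_ne j fun k hk => hrep k ?_)
  by_cases hki : k = i
  · rw [hki, h0]
  · exact h k hki hk

theorem exists_four_others {i i' j : Fin 7} (h : i ≠ i') (hj : j ≠ i) (hj' : j ≠ i') :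
    ∃ g : Fin 4 → Fin 7, Function.Injective g ∧
      (∀ m, g m ≠ i ∧ g m ≠ i' ∧ g m ≠ j) ∧
      ∀ k, k ≠ i → k ≠ i' → k ≠ j → ∃ m, g m = k := by
  have hc : (({i, i', j} : Finset (Fin 7))ᶜ).card = 4 := by
    rw [Finset.card_compl, Finset.card_eq_three.2 ⟨i, i', j, h, hj.symm, hj'.symm, rfl⟩]
    rfl
  let g := ({i, i', j} : Finset (Fin 7))ᶜ.orderEmbOfFin hc
  refine ⟨g, g.injective, fun m => ?_, fun k h1 h2 h3 => ?_⟩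
  · have hm : g m ∈ ({i, i', j} : Finset (Fin 7))ᶜ := Finset.orderEmbOfFin_mem _ hc m
    rwa [Finset.mem_compl, Finset.mem_insert, Finset.mem_insert, Finset.mem_singleton, not_or,
      not_or] at hm
  · have : k ∈ Set.range g := by
      rw [Finset.range_orderEmbOfFin]; simp [h1, h2, h3]
    exact this

/-- Adjacent vertices of the hexagon obtained by removing `f j` lie on opposite sides of the
conics through the remaining five points. -/
theorem outAll_iff_not_outAll_succ {f : Fin 7 → RP2} (hf : TypicalCfg f)
    (hconv : ConsecConvexPos f) {i j : Fin 7} (hj : j ≠ i) (hj' : j ≠ i + 1) :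
    OutAll f i j ↔ ¬ OutAll f (i + 1) j := by
  obtain ⟨φ, hφ⟩ := hconv
  have h0 := hφ.1.2.1
  have hii : i ≠ i + 1 := by simp
  obtain ⟨g, ginj, gne, gsurj⟩ := exists_four_others hii hj hj'
  set v : Fin 7 → Fin 3 → ℝ := fun k => chart φ (f k) with hv
  have hbr : ∀ {k l m : Fin 7}, k ≠ l → k ≠ m → l ≠ m → bracket (v k) (v l) (v m) ≠ 0 :=
    fun h1 h2 h3 => hf.1.bracket_chart_ne_zero h0 h1 h2 h3
  have hpos : ∀ {m n : Fin 4}, m ≠ n →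
      0 < bracket (v (g m)) (v (g n)) (v i) * bracket (v (g m)) (v (g n)) (v (i + 1)) :=
    fun {m n} hmn => hφ.bracket_mul_pos hf.1 (ginj.ne hmn) (gne m).1 (gne m).2.1 (gne n).1
      (gne n).2.1
  have hq : ∀ k, (∀ m, g m ≠ k) →
      pencilConic (v k) (v (g 0)) (v (g 1)) (v (g 2)) (v (g 3)) ≠ 0 := by
    intro k hk hzero
    have h1 := polar_pencilConic (v k) (v (g 0)) (v (g 1)) (v (g 2)) (v (g 3)) (v (g 0)) (v (g 1))
    rw [hzero] at h1
    simp only [QuadraticMap.polar, zero_apply, bracket_self_left,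
      bracket_self_right] at h1
    have h2 : bracket (v (g 0)) (v (g 1)) (v k) * bracket (v (g 2)) (v (g 3)) (v k) *
        (bracket (v (g 1)) (v (g 2)) (v (g 0)) * bracket (v (g 3)) (v (g 0)) (v (g 1))) ≠ 0 := by
      refine mul_ne_zero (mul_ne_zero ?_ ?_) (mul_ne_zero ?_ ?_) <;> apply hbr <;>
        first | exact hk _ | exact ginj.ne (by decide)
    exact h2 (by linarith)
  have hvan : ∀ k l, (∀ m, m ≠ l → m ≠ j → m = k ∨ ∃ n, g n = m) → ∀ m, m ≠ l → m ≠ j →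
      pencilConic (v k) (v (g 0)) (v (g 1)) (v (g 2)) (v (g 3)) (v m) = 0 := by
    intro k l hkl m hml hmj
    rw [pencilConic_apply]
    rcases hkl m hml hmj with rfl | ⟨n, rfl⟩
    · ring
    · fin_cases n <;> simp [bracket_self_left, bracket_self_right]
  obtain ⟨hi, hqi⟩ := outAll_iff_anisotropicPlane hf h0
    (hq (i + 1) fun m => (gne m).2.1) (hvan (i + 1) i fun m h1 h2 => by
      by_cases h : m = i + 1
      · exact Or.inl h
      · exact Or.inr (gsurj m h1 h h2))
  obtain ⟨hi', -⟩ := outAll_iff_anisotropicPlane hf h0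
    (hq i fun m => (gne m).1) (hvan i (i + 1) fun m h1 h2 => by
      by_cases h : m = i
      · exact Or.inl h
      · exact Or.inr (gsurj m h h1 h2))
  rw [hi, hi']
  refine anisotropicPlane_pencilConic_iff_not hqi ?_ (hpos (by decide)) (hpos (by decide))
    (hpos (by decide)) (hpos (by decide)) (hpos (by decide)) (hpos (by decide))
  refine mul_ne_zero (mul_ne_zero (mul_ne_zero ?_ ?_) ?_) ?_ <;> apply hbr <;>
    exact ginj.ne (by decide)

theorem dIdx_add_dIdx_succ {f : Fin 7 → RP2} (hf : TypicalCfg f)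
    (hconv : ConsecConvexPos f) {i j : Fin 7} (hj : j ≠ i) (hj' : j ≠ i + 1) :
    dIdx f i j + dIdx f (i + 1) j = 1 := by
  have h := outAll_iff_not_outAll_succ hf hconv hj hj'
  unfold dIdx
  by_cases h' : OutAll f (i + 1) j <;> simp [h, h']

theorem domIdx_add_domIdx_succ {f : Fin 7 → RP2} (hf : TypicalCfg f)
    (hconv : ConsecConvexPos f) (i : Fin 7) :
    domIdx f i + domIdx f (i + 1) = 5 + (dIdx f i (i + 1) + dIdx f (i + 1) i) := by
  have hii : i ≠ i + 1 := by simp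
  set s := (Finset.univ.erase i).erase (i + 1) with hs
  have hsum : ∑ j ∈ s, (dIdx f i j + dIdx f (i + 1) j) = 5 := by
    rw [Finset.sum_congr rfl fun j hj => dIdx_add_dIdx_succ hf hconv
      (Finset.ne_of_mem_erase (Finset.mem_of_mem_erase hj)) (Finset.ne_of_mem_erase hj)]
    rw [Finset.sum_const, Finset.card_erase_of_mem (by simp), Finset.card_erase_of_mem (by simp)]
    rfl
  have h1 : domIdx f i = dIdx f i (i + 1) + ∑ j ∈ s, dIdx f i j :=
    (Finset.add_sum_erase _ _ (by simp)).symm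
  have h2 : domIdx f (i + 1) = dIdx f (i + 1) i + ∑ j ∈ s, dIdx f (i + 1) j := by
    rw [hs, Finset.erase_right_comm]
    exact (Finset.add_sum_erase _ _ (by simp)).symm
  rw [Finset.sum_add_distrib] at hsum
  omega

/-- For a heptagonal typical 7-configuration numbered consecutively along the convex
position, the dominance indices of the endpoints of an internal edge sum to 5, and those of
an external edge sum to 7. -/
theorem edge_dominance_sum (f : Fin 7 → RP2)
    (hf : TypicalCfg f) (hconv : ConsecConvexPos f) (i : Fin 7) :
    (InternalEdge f i → domIdx f i + domIdx f (i + 1) = 5) ∧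
    (ExternalEdge f i → domIdx f i + domIdx f (i + 1) = 7) := by
  have h := domIdx_add_domIdx_succ hf hconv i
  constructor
  · rintro ⟨h1, h2⟩
    omega
  · rintro ⟨h1, h2⟩
    omega

end
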